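/- Let σ_t and σ_{t-1} be real numbers with 0 ≤ σ_{t-1} ≤ σ_t and σ_t > 0. Suppose σ_ret and σ_inj are nonnegative real numbers satisfying (i) the variance-matching condition σ_{t-1}² = σ_ret² + σ_inj², and (ii) the fluctuation–dissipation coupling σ_inj² = 2·(1 - σ_ret/σ_t)·(σ_t·σ_ret). Then σ_ret and σ_inj are uniquely determined and given in closed form by σ_ret = σ_t - √(σ_t² - σ_{t-1}²) and σ_inj = √(σ_{t-1}² - σ_ret²). -/

import Mathlib

/-- **Closed-form drift/noise split under variance preservation
(Proposition: variance matching + fluctuation–dissipation coupling).**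
Let `0 ≤ σtm1 ≤ σt` with `σt > 0` and let `σret, σinj ≥ 0` satisfy
(i) variance matching `σtm1² = σret² + σinj²` and
(ii) the fluctuation–dissipation coupling `σinj² = 2 (1 - σret/σt) (σt σret)`.
Then `σret` and `σinj` are uniquely determined:
`σret = σt - √(σt² - σtm1²)` and `σinj = √(σtm1² - σret²)`. -/
theorem vp_langevin_closed_form
    (σt σtm1 σret σinj : ℝ)
    (h0 : 0 ≤ σtm1) (h1 : σtm1 ≤ σt) (hσt : 0 < σt)
    (hret : 0 ≤ σret) (hinj : 0 ≤ σinj)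
    (hmatch : σtm1 ^ 2 = σret ^ 2 + σinj ^ 2)
    (hfd : σinj ^ 2 = 2 * (1 - σret / σt) * (σt * σret)) :
    σret = σt - Real.sqrt (σt ^ 2 - σtm1 ^ 2) ∧
    σinj = Real.sqrt (σtm1 ^ 2 - σret ^ 2) := by
  have hinj_sq : σinj ^ 2 = 2 * (σt - σret) * σret := by
    rw [hfd]
    field_simp
  have hle : σret ≤ σt := by
    by_contra! hlt
    nlinarith [sq_nonneg σinj, mul_pos (sub_pos.mpr hlt) (hσt.trans hlt)]
  have hgap : σt ^ 2 - σtm1 ^ 2 = (σt - σret) ^ 2 := by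
    rw [hmatch, hinj_sq]
    ring
  constructor
  · rw [hgap, Real.sqrt_sq (sub_nonneg.mpr hle)]
    ring
  · rw [hmatch, add_sub_cancel_left, Real.sqrt_sq hinj]
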